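/- arXiv:0710.0376 — 2 statements merged into one kernel-verified Lean document; each statement's English description precedes it below -/
import Mathlib

section
/- (Character expansion integral over the unitary group, used in the boson–boson block.) Let n ≥ 1 and K ≥ 0 be integers. There is a nonzero constant c = c(n,K) ∈ ℂ, independent of H, such that for every n×n complex matrix H: ∫_{U(n)} (conj(det U))^K · exp(Tr(U·H)) dμ_Haar(U) = c · (det H)^K, where μ_Haar is the normalized Haar probability measure on the unitary group U(n). (For n = 1 this reduces to ∮ e^{−iKθ} e^{h e^{iθ}} dθ/2π = h^K/K!.) -/
open MeasureTheory Matrix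

noncomputable instance (n : ℕ) : MeasurableSpace (Matrix.unitaryGroup (Fin n) ℂ) :=
  borel _

instance (n : ℕ) : BorelSpace (Matrix.unitaryGroup (Fin n) ℂ) := ⟨rfl⟩

instance (n : ℕ) : CompactSpace (Matrix.unitaryGroup (Fin n) ℂ) := by
  have hclosed : IsClosed (Matrix.unitaryGroup (Fin n) ℂ : Set (Matrix (Fin n) (Fin n) ℂ)) :=
    isClosed_unitary
  open scoped Matrix.Norms.Elementwise in
  exact isCompact_iff_compactSpace.mp <| Metric.isCompact_of_isClosed_isBounded
    hclosed <| isBounded_iff_forall_norm_le.mpr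
      ⟨1, fun _ hU => entrywise_sup_norm_bound_of_unitary hU⟩

/-- Integration against a finite measure, as a continuous linear functional on the continuous
functions on a compact space. -/
noncomputable def ContinuousMap.integralCLM {X : Type*} [TopologicalSpace X] [CompactSpace X]
    [MeasurableSpace X] [BorelSpace X] (μ : Measure X) [IsFiniteMeasure μ] :
    C(X, ℂ) →L[ℂ] ℂ :=
  LinearMap.mkContinuous
    { toFun := fun f => ∫ x, f x ∂μ
      map_add' := fun f g => integral_add
        (f.continuous.integrable_of_hasCompactSupport (HasCompactSupport.of_compactSpace f))
        (g.continuous.integrable_of_hasCompactSupport (HasCompactSupport.of_compactSpace g))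
      map_smul' := fun c f => integral_smul c f }
    (μ.real Set.univ) fun f => by
      rw [mul_comm]
      exact norm_integral_le_of_norm_le_const (.of_forall f.norm_coe_le_norm)

theorem ContinuousMap.integralCLM_apply {X : Type*} [TopologicalSpace X] [CompactSpace X]
    [MeasurableSpace X] [BorelSpace X] (μ : Measure X) [IsFiniteMeasure μ] (f : C(X, ℂ)) :
    ContinuousMap.integralCLM μ f = ∫ x, f x ∂μ :=
  rfl

theorem ContinuousMap.exp_apply {X : Type*} [TopologicalSpace X] [CompactSpace X]
    (f : C(X, ℂ)) (x : X) : NormedSpace.exp f x = Complex.exp (f x) := by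
  rw [Complex.exp_eq_exp_ℂ]
  exact NormedSpace.map_exp (ContinuousMap.evalAlgHom ℂ ℂ x) (continuous_eval_const x) f

/-- A continuous functional which vanishes on the exponentials of a linear space vanishes on the
algebra generated by that space. -/
theorem map_eq_zero_of_map_exp_eq_zero {E A : Type*} [AddCommGroup E] [Module ℂ E]
    [NormedCommRing A] [NormedAlgebra ℂ A] [CompleteSpace A] (φ : A →L[ℂ] ℂ) (L : E →ₗ[ℂ] A)
    (h : ∀ x, φ (NormedSpace.exp (L x)) = 0) {a : A}
    (ha : a ∈ Algebra.adjoin ℂ (Set.range L)) : φ a = 0 := by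
  let _ : NormedAlgebra ℚ A := NormedAlgebra.restrictScalars ℚ ℂ A
  have key : ∀ f : A, (∀ x, φ (f * NormedSpace.exp (L x)) = 0) →
      ∀ x, φ (a * f * NormedSpace.exp (L x)) = 0 := by
    induction ha using Algebra.adjoin_induction with
    | mem a ha =>
      obtain ⟨y, rfl⟩ := ha
      intro f hf x
      have hd : HasDerivAt (fun t : ℂ => φ (f * NormedSpace.exp (L x) *
          NormedSpace.exp (t • L y))) (φ (f * NormedSpace.exp (L x) *
          (NormedSpace.exp ((0 : ℂ) • L y) * L y))) 0 :=
        φ.hasFDerivAt.comp_hasDerivAt 0 ((hasDerivAt_exp_smul_const (L y) (0 : ℂ)).const_mul _)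
      have hz : (fun t : ℂ => φ (f * NormedSpace.exp (L x) *
          NormedSpace.exp (t • L y))) = fun _ => 0 := by
        funext t
        rw [mul_assoc, ← NormedSpace.exp_add, ← map_smul, ← map_add, hf]
      rw [hz] at hd
      have := hd.unique (hasDerivAt_const _ _)
      rw [← this, zero_smul, NormedSpace.exp_zero, one_mul]
      congr 1
      ring
    | algebraMap r =>
      intro f hf x
      rw [mul_assoc, ← Algebra.smul_def, map_smul, hf, smul_zero]
    | add a b _ _ iha ihb =>
      intro f hf x
      rw [add_mul, add_mul, map_add, iha f hf, ihb f hf, add_zero]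
    | mul a b _ _ iha ihb =>
      intro f hf x
      rw [mul_assoc a b f, iha _ (ihb f hf)]
  simpa using key 1 (by simpa using h) 0

/-- **The unitary trick**: an entire function on a unital Banach star-algebra is determined by
its values on the unitary elements. -/
theorem AnalyticOnNhd.eq_zero_of_forall_unitary {A : Type*} [NormedRing A] [NormedAlgebra ℂ A]
    [CompleteSpace A] [StarRing A] [StarModule ℂ A] [ContinuousStar A] {G : A → ℂ}
    (hG : AnalyticOnNhd ℂ G Set.univ) (h : ∀ u ∈ unitary A, G u = 0) : G = 0 := by
  have hexp : ∀ b : A, G (NormedSpace.exp b) = 0 := by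
    intro b
    set g : ℂ → ℂ := fun w => G (NormedSpace.exp (Complex.I •
      (w • (realPart b : A) + (imaginaryPart b : A)))) with hg
    have hga : AnalyticOnNhd ℂ g Set.univ := by
      intro w _
      refine (hG _ trivial).fun_comp ((NormedSpace.exp_analytic (𝕂 := ℂ) _).fun_comp ?_)
      fun_prop
    have hreal : ∀ t : ℝ, g t = 0 := by
      intro t
      have := h _ (selfAdjoint.expUnitary (t • realPart b + imaginaryPart b)).2
      simpa [hg, selfAdjoint.expUnitary_coe] using this
    have hfreq : ∃ᶠ w in nhdsWithin (0 : ℂ) {0}ᶜ, g w = 0 := by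
      have ht : Filter.Tendsto (fun t : ℝ => (t : ℂ)) (nhdsWithin 0 {0}ᶜ)
          (nhdsWithin (0 : ℂ) {0}ᶜ) := by
        refine tendsto_nhdsWithin_of_tendsto_nhds_of_eventually_within _ ?_ ?_
        · exact (Complex.continuous_ofReal.tendsto' 0 0 (by simp)).mono_left nhdsWithin_le_nhds
        · filter_upwards [self_mem_nhdsWithin] with t ht
          simpa using ht
      exact ht.frequently (Filter.Eventually.of_forall hreal).frequently
    have hg0 : g = 0 := hga.eq_of_frequently_eq (fun _ _ => analyticAt_const) hfreq
    have := congrFun hg0 (-Complex.I)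
    simpa [hg, smul_smul, smul_add, realPart_add_I_smul_imaginaryPart] using this
  refine hG.eq_of_eventuallyEq (z₀ := 1) (fun _ _ => analyticAt_const) ?_
  have hmap : Filter.map NormedSpace.exp (nhds (0 : A)) = nhds 1 := by
    simpa using HasStrictFDerivAt.map_nhds_eq_of_equiv
      (f' := ContinuousLinearEquiv.refl ℂ A) (hasStrictFDerivAt_exp_zero (𝕂 := ℂ) (𝔸 := A))
  rw [Filter.EventuallyEq, ← hmap, Filter.eventually_map]
  exact .of_forall hexp

namespace Matrix

open scoped Matrix.Norms.L2Operator

theorem analyticOnNhd_det {n : ℕ} :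
    AnalyticOnNhd ℂ (fun H : Matrix (Fin n) (Fin n) ℂ => H.det) Set.univ := by
  intro H _
  simp_rw [det_apply]
  refine Finset.analyticAt_fun_sum _ fun σ _ => ?_
  refine AnalyticAt.fun_const_smul (c := (Equiv.Perm.sign σ : ℤ)) (Finset.analyticAt_fun_prod _ fun i _ => ?_)
  exact (LinearMap.toContinuousLinearMap
    (Matrix.entryLinearMap ℂ ℂ (σ i) i : Matrix (Fin n) (Fin n) ℂ →ₗ[ℂ] ℂ)).analyticAt H

/-- The linear map sending `H` to the function `U ↦ Tr (U H)` on the unitary group. -/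
noncomputable def unitaryTracePairing (n : ℕ) :
    Matrix (Fin n) (Fin n) ℂ →ₗ[ℂ] C(unitaryGroup (Fin n) ℂ, ℂ) where
  toFun H := ⟨fun U => trace ((U : Matrix (Fin n) (Fin n) ℂ) * H), by fun_prop⟩
  map_add' H H' := by ext U; simp [mul_add]
  map_smul' c H := by ext U; simp

/-- The determinant as a continuous function on the unitary group. -/
noncomputable def unitaryDet (n : ℕ) : C(unitaryGroup (Fin n) ℂ, ℂ) :=
  ⟨fun U => det (U : Matrix (Fin n) (Fin n) ℂ), by fun_prop⟩

theorem unitaryDet_mem_adjoin (n : ℕ) :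
    unitaryDet n ∈ Algebra.adjoin ℂ (Set.range (unitaryTracePairing n)) := by
  have : unitaryDet n = ∑ σ : Equiv.Perm (Fin n), (Equiv.Perm.sign σ : ℤ) •
      ∏ i, unitaryTracePairing n (single i (σ i) 1) := by
    ext U
    simp [unitaryDet, unitaryTracePairing, det_apply, trace_mul_single, Units.smul_def]
  rw [this]
  exact sum_mem fun σ _ => zsmul_mem (Subalgebra.prod_mem _ fun i _ =>
    Algebra.subset_adjoin (Set.mem_range_self _)) _

theorem star_det_mul_det_of_mem_unitaryGroup {n : ℕ} (U : unitaryGroup (Fin n) ℂ) :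
    starRingEnd ℂ (det (U : Matrix (Fin n) (Fin n) ℂ)) *
      det (U : Matrix (Fin n) (Fin n) ℂ) = 1 := by
  rw [starRingEnd_apply, ← det_conjTranspose, ← det_mul, ← star_eq_conjTranspose,
    Unitary.coe_star_mul_self, det_one]

/-- The functional `f ↦ ∫ (conj det U)^K f(U) dμ(U)` on continuous functions on the unitary
group. -/
noncomputable def unitaryDetFunctional {n : ℕ} (μ : Measure (unitaryGroup (Fin n) ℂ))
    [IsFiniteMeasure μ] (K : ℕ) : C(unitaryGroup (Fin n) ℂ, ℂ) →L[ℂ] ℂ :=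
  ContinuousMap.integralCLM μ ∘L ContinuousLinearMap.mul ℂ _ (star (unitaryDet n) ^ K)

theorem unitaryDetFunctional_apply {n : ℕ} (μ : Measure (unitaryGroup (Fin n) ℂ))
    [IsFiniteMeasure μ] (K : ℕ) (f : C(unitaryGroup (Fin n) ℂ, ℂ)) :
    unitaryDetFunctional μ K f =
      ∫ U, starRingEnd ℂ (det (U : Matrix (Fin n) (Fin n) ℂ)) ^ K * f U ∂μ :=
  rfl

theorem unitaryDetFunctional_exp_mul {n : ℕ} (μ : Measure (unitaryGroup (Fin n) ℂ))
    [μ.IsMulLeftInvariant] [IsFiniteMeasure μ] (K : ℕ) (V : unitaryGroup (Fin n) ℂ)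
    (H : Matrix (Fin n) (Fin n) ℂ) :
    unitaryDetFunctional μ K (NormedSpace.exp (unitaryTracePairing n (H * V))) =
      unitaryDetFunctional μ K (NormedSpace.exp (unitaryTracePairing n H)) *
        det (V : Matrix (Fin n) (Fin n) ℂ) ^ K := by
  simp only [unitaryDetFunctional_apply, ContinuousMap.exp_apply]
  rw [← integral_mul_left_eq_self (fun U : unitaryGroup (Fin n) ℂ => starRingEnd ℂ
    (det (U : Matrix (Fin n) (Fin n) ℂ)) ^ K * Complex.exp (unitaryTracePairing n H U)) V, ← integral_mul_const]
  refine integral_congr_ae (.of_forall fun U => ?_)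
  have htr : unitaryTracePairing n (H * V) U = unitaryTracePairing n H (V * U) := by
    simp only [unitaryTracePairing, LinearMap.coe_mk, AddHom.coe_mk, ContinuousMap.coe_mk,
      Submonoid.coe_mul]
    rw [← mul_assoc, trace_mul_comm, mul_assoc]
  have hV := congrArg (· ^ K) (star_det_mul_det_of_mem_unitaryGroup V)
  simp only [mul_pow, one_pow] at hV
  simp only [htr, Submonoid.coe_mul, det_mul, map_mul, mul_pow]
  linear_combination (-(starRingEnd ℂ (det (U : Matrix (Fin n) (Fin n) ℂ)) ^ K *
    Complex.exp (unitaryTracePairing n H (V * U)))) * hV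

theorem unitaryDetFunctional_exp {n : ℕ} (μ : Measure (unitaryGroup (Fin n) ℂ))
    [μ.IsMulLeftInvariant] [IsFiniteMeasure μ] (K : ℕ) (H : Matrix (Fin n) (Fin n) ℂ) :
    unitaryDetFunctional μ K (NormedSpace.exp (unitaryTracePairing n H)) =
      unitaryDetFunctional μ K (NormedSpace.exp (unitaryTracePairing n 1)) * H.det ^ K := by
  have hG : AnalyticOnNhd ℂ (fun H : Matrix (Fin n) (Fin n) ℂ =>
      unitaryDetFunctional μ K (NormedSpace.exp (unitaryTracePairing n H)) -
      unitaryDetFunctional μ K (NormedSpace.exp (unitaryTracePairing n 1)) * H.det ^ K)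
      Set.univ := by
    intro H _
    refine AnalyticAt.fun_sub ?_ (analyticAt_const.fun_mul ((analyticOnNhd_det H trivial).fun_pow K))
    exact ((unitaryDetFunctional μ K).analyticAt _).fun_comp
      ((NormedSpace.exp_analytic (𝕂 := ℂ) _).fun_comp
        ((LinearMap.toContinuousLinearMap (unitaryTracePairing n)).analyticAt H))
  refine sub_eq_zero.mp (congrFun (hG.eq_zero_of_forall_unitary fun V hV => ?_) H)
  have := unitaryDetFunctional_exp_mul μ K ⟨V, hV⟩ 1
  rw [one_mul] at this
  exact sub_eq_zero.mpr this

theorem unitaryDetFunctional_exp_one_ne_zero {n : ℕ} (μ : Measure (unitaryGroup (Fin n) ℂ))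
    [μ.IsMulLeftInvariant] [IsProbabilityMeasure μ] (K : ℕ) :
    unitaryDetFunctional μ K (NormedSpace.exp (unitaryTracePairing n 1)) ≠ 0 := by
  intro h0
  have h := map_eq_zero_of_map_exp_eq_zero (unitaryDetFunctional μ K) (unitaryTracePairing n)
    (fun H => by rw [unitaryDetFunctional_exp, h0, zero_mul])
    (pow_mem (unitaryDet_mem_adjoin n) K)
  rw [unitaryDetFunctional_apply] at h
  have hone : ∀ U : unitaryGroup (Fin n) ℂ,
      starRingEnd ℂ (det (U : Matrix (Fin n) (Fin n) ℂ)) ^ K * (unitaryDet n ^ K) U = 1 := by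
    intro U
    rw [ContinuousMap.pow_apply, ← mul_pow]
    exact (congrArg (· ^ K) (star_det_mul_det_of_mem_unitaryGroup U)).trans (one_pow K)
  simp only [hone] at h
  simp at h

end Matrix

/-- Character expansion integral over the unitary group (boson–boson block):
`∫_{U(n)} (conj det U)^K exp(Tr(U H)) dμ_Haar(U) = c · (det H)^K` for a nonzero
constant `c` independent of `H`, where `μ_Haar` is the normalized Haar
probability measure on `U(n)`. -/
theorem stmt_11 (n : ℕ) (hn : 1 ≤ n) (K : ℕ)
    (μ : Measure (Matrix.unitaryGroup (Fin n) ℂ))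
    [μ.IsHaarMeasure] [IsProbabilityMeasure μ] :
    ∃ c : ℂ, c ≠ 0 ∧ ∀ H : Matrix (Fin n) (Fin n) ℂ,
      ∫ U : Matrix.unitaryGroup (Fin n) ℂ,
          (starRingEnd ℂ (Matrix.det (U : Matrix (Fin n) (Fin n) ℂ))) ^ K *
            Complex.exp (Matrix.trace ((U : Matrix (Fin n) (Fin n) ℂ) * H)) ∂μ
        = c * H.det ^ K := by
  refine ⟨_, Matrix.unitaryDetFunctional_exp_one_ne_zero μ K, fun H => ?_⟩
  rw [← Matrix.unitaryDetFunctional_exp μ K H, Matrix.unitaryDetFunctional_apply]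
  simp only [ContinuousMap.exp_apply]
  rfl
end

section
/- (Purely bosonic superbosonisation / complex Wishart pushforward: the case n_f = 0 of the superbosonisation theorem.) Let N ≥ n ≥ 1 be integers. There exists a constant c > 0 such that for every continuous compactly supported function f on the n×n complex matrices: ∫ f(Ψ·Ψᴴ) dΨ = c · ∫_{H > 0} (det H)^{N−n} · f(H) dH, where the left integral is over all n×N complex matrices Ψ with Lebesgue measure on the entries, and the right integral is over the positive-definite Hermitian n×n matrices H with the Lebesgue measure of the real vector space of Hermitian n×n matrices. (Here det H > 0 for H positive definite.) -/
open MeasureTheory Matrix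
open scoped ComplexOrder

noncomputable instance (n m : ℕ) : MeasurableSpace (Matrix (Fin n) (Fin m) ℂ) :=
  borel _

instance (n m : ℕ) : BorelSpace (Matrix (Fin n) (Fin m) ℂ) := ⟨rfl⟩

namespace MatrixWishart

open scoped ENNReal

variable {n m : ℕ}

/-- Invariance of a measure under the congruence action `x ↦ g x gᴴ` of `GL n ℂ`. -/
def IsCongrInvariant (α : Measure (Matrix (Fin n) (Fin n) ℂ)) : Prop :=
  ∀ g : Matrix (Fin n) (Fin n) ℂ, IsUnit g.det → ∀ F : Matrix (Fin n) (Fin n) ℂ → ℝ≥0∞,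
    Measurable F → ∫⁻ x, F (g * x * gᴴ) ∂α = ∫⁻ x, F x ∂α

/-- Invariance up to the factor `|det g| ^ (2 N)` under the congruence action of `GL n ℂ`. -/
def IsRelCongrInvariant (N : ℕ) (β : Measure (Matrix (Fin n) (Fin n) ℂ)) : Prop :=
  ∀ g : Matrix (Fin n) (Fin n) ℂ, IsUnit g.det → ∀ F : Matrix (Fin n) (Fin n) ℂ → ℝ≥0∞,
    Measurable F → ‖g.det‖ₑ ^ (2 * N) * ∫⁻ x, F (g * x * gᴴ) ∂β = ∫⁻ x, F x ∂β

/-- Invariance of a measure under right multiplication by `GL n ℂ`. -/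
def IsRightInvariant (γ : Measure (Matrix (Fin n) (Fin n) ℂ)) : Prop :=
  ∀ s : Matrix (Fin n) (Fin n) ℂ, IsUnit s.det → ∀ F : Matrix (Fin n) (Fin n) ℂ → ℝ≥0∞,
    Measurable F → ∫⁻ g, F (g * s) ∂γ = ∫⁻ g, F g ∂γ

instance : SecondCountableTopology (Matrix (Fin n) (Fin m) ℂ) :=
  inferInstanceAs (SecondCountableTopology (Fin n → Fin m → ℂ))

theorem measurable_inv : Measurable fun x : Matrix (Fin n) (Fin n) ℂ => x⁻¹ := by
  have h1 : Measurable fun x : Matrix (Fin n) (Fin n) ℂ => Ring.inverse x.det := by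
    simp only [Ring.inverse_eq_inv']
    exact (continuous_id.matrix_det.measurable).inv
  have h2 : Measurable fun x : Matrix (Fin n) (Fin n) ℂ => x.adjugate :=
    continuous_id.matrix_adjugate.measurable
  simp only [Matrix.inv_def]
  have h3 : Continuous fun p : ℂ × Matrix (Fin n) (Fin n) ℂ => p.1 • p.2 :=
    continuous_fst.smul continuous_snd
  exact h3.measurable.comp (h1.prodMk h2)

theorem _root_.Matrix.PosDef.exists_eq_mul_self {x : Matrix (Fin n) (Fin n) ℂ}
    (hx : x.PosDef) : ∃ s : Matrix (Fin n) (Fin n) ℂ, IsUnit s.det ∧ sᴴ = s ∧ x = s * s := by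
  open scoped MatrixOrder Matrix.Norms.L2Operator in
  have h := CFC.sqrt_mul_sqrt_self x hx.posSemidef.nonneg
  refine ⟨CFC.sqrt x, ?_, (CFC.sqrt_nonneg x).isSelfAdjoint, h.symm⟩
  have h2 : IsUnit (CFC.sqrt x * CFC.sqrt x).det := by
    rw [h]; exact (Matrix.isUnit_iff_isUnit_det x).1 hx.isUnit
  rw [Matrix.det_mul] at h2
  exact isUnit_of_mul_isUnit_left h2

theorem measurable_mul_conjTranspose_self :
    Measurable fun g : Matrix (Fin n) (Fin m) ℂ => g * gᴴ :=
  (Continuous.matrix_mul continuous_id continuous_id.matrix_conjTranspose).measurable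

theorem measurable_congr : Measurable fun p : Matrix (Fin n) (Fin n) ℂ × Matrix (Fin n) (Fin n) ℂ =>
    p.1 * p.2 * p.1ᴴ :=
  ((continuous_fst.matrix_mul continuous_snd).matrix_mul
    continuous_fst.matrix_conjTranspose).measurable

theorem measurable_snd_inv :
    Measurable fun p : Matrix (Fin n) (Fin n) ℂ × Matrix (Fin n) (Fin n) ℂ => p.2⁻¹ :=
  measurable_inv.comp measurable_snd

theorem measurable_congr_inv :
    Measurable fun p : Matrix (Fin n) (Fin n) ℂ × Matrix (Fin n) (Fin n) ℂ =>
      p.1 * p.2⁻¹ * p.1ᴴ := by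
  have h := measurable_congr.comp (measurable_fst.prodMk (measurable_snd_inv (n := n)))
  exact h

theorem lintegral_mul_lintegral_eq {γ α : Measure (Matrix (Fin n) (Fin n) ℂ)} [SFinite γ]
    [SFinite α] (hγ : IsRightInvariant γ) (hγ' : ∀ᵐ g ∂γ, IsUnit g.det)
    (hα : IsCongrInvariant α) (hα' : ∀ᵐ x ∂α, x.PosDef)
    {F K : Matrix (Fin n) (Fin n) ℂ → ℝ≥0∞} (hF : Measurable F) (hK : Measurable K) :
    (∫⁻ g, K (g * gᴴ) ∂γ) * ∫⁻ x, F x ∂α = (∫⁻ x, K x⁻¹ ∂α) * ∫⁻ g, F (g * gᴴ) ∂γ := by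
  have hKs : Measurable fun g : Matrix (Fin n) (Fin n) ℂ => K (g * gᴴ) :=
    hK.comp measurable_mul_conjTranspose_self
  have hFs : Measurable fun g : Matrix (Fin n) (Fin n) ℂ => F (g * gᴴ) :=
    hF.comp measurable_mul_conjTranspose_self
  have hFm : Measurable fun p : Matrix (Fin n) (Fin n) ℂ × Matrix (Fin n) (Fin n) ℂ =>
      F (p.1 * p.2 * p.1ᴴ) := hF.comp measurable_congr
  have hKm : Measurable fun p : Matrix (Fin n) (Fin n) ℂ × Matrix (Fin n) (Fin n) ℂ =>
      K (p.1 * p.2⁻¹ * p.1ᴴ) :=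
    hK.comp measurable_congr_inv
  calc (∫⁻ g, K (g * gᴴ) ∂γ) * ∫⁻ x, F x ∂α
      = ∫⁻ g, ∫⁻ x, K (g * gᴴ) * F (g * x * gᴴ) ∂α ∂γ := by
        rw [← lintegral_mul_const _ hKs]
        refine lintegral_congr_ae (hγ'.mono fun g hg => ?_)
        dsimp only
        rw [← hα g hg F hF, lintegral_const_mul]
        have h := hFm.comp (measurable_prodMk_left (x := g))
        exact h
    _ = ∫⁻ x, ∫⁻ g, K (g * gᴴ) * F (g * x * gᴴ) ∂γ ∂α := by
        refine lintegral_lintegral_swap (Measurable.aemeasurable ?_)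
        exact (hKs.comp measurable_fst).mul hFm
    _ = ∫⁻ x, ∫⁻ g, K (g * x⁻¹ * gᴴ) * F (g * gᴴ) ∂γ ∂α := by
        refine lintegral_congr_ae (hα'.mono fun x hx => ?_)
        obtain ⟨s, hs, hsH, rfl⟩ := hx.exists_eq_mul_self
        dsimp only
        rw [← hγ s hs fun g => K (g * (s * s)⁻¹ * gᴴ) * F (g * gᴴ)]
        · refine lintegral_congr fun g => ?_
          congr 2
          · simp only [Matrix.mul_inv_rev, Matrix.conjTranspose_mul, hsH, ← Matrix.mul_assoc,
              Matrix.mul_nonsing_inv_cancel_right _ _ hs, Matrix.nonsing_inv_mul_cancel_right _ _ hs]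
          · simp only [Matrix.conjTranspose_mul, hsH, Matrix.mul_assoc]
        · exact (hKm.comp measurable_prodMk_right).mul hFs
    _ = ∫⁻ g, ∫⁻ x, K (g * x⁻¹ * gᴴ) * F (g * gᴴ) ∂α ∂γ := by
        refine (lintegral_lintegral_swap (Measurable.aemeasurable ?_)).symm
        exact hKm.mul ((hFs).comp measurable_fst)
    _ = (∫⁻ x, K x⁻¹ ∂α) * ∫⁻ g, F (g * gᴴ) ∂γ := by
        rw [← lintegral_const_mul _ (hFs)]
        refine lintegral_congr_ae (hγ'.mono fun g hg => ?_)
        dsimp only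
        have hgH : IsUnit (gᴴ).det := by simpa [Matrix.det_conjTranspose] using hg
        have hg' : IsUnit (gᴴ⁻¹).det := by rwa [Matrix.isUnit_nonsing_inv_det_iff]
        have hKg := hKm.comp (measurable_prodMk_left (x := g))
        simp only [Function.comp_def] at hKg
        rw [lintegral_mul_const _ hKg,
          ← hα _ hg' (fun x => K x⁻¹) (hK.comp measurable_inv)]
        congr 1
        refine lintegral_congr fun x => ?_
        simp [Matrix.mul_inv_rev, Matrix.conjTranspose_nonsing_inv, Matrix.mul_assoc,
          Matrix.nonsing_inv_nonsing_inv _ hg, Matrix.nonsing_inv_nonsing_inv _ hgH]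

theorem enorm_det_ne_zero {g : Matrix (Fin n) (Fin n) ℂ} (hg : IsUnit g.det) : ‖g.det‖ₑ ≠ 0 := by
  simpa using hg.ne_zero

theorem measurable_enorm_det : Measurable fun x : Matrix (Fin n) (Fin n) ℂ => ‖x.det‖ₑ :=
  continuous_id.matrix_det.measurable.enorm

theorem measurable_enorm_det_pow_inv (N : ℕ) :
    Measurable fun x : Matrix (Fin n) (Fin n) ℂ => (‖x.det‖ₑ ^ N)⁻¹ :=
  (measurable_enorm_det.pow_const N).inv

theorem measurable_enorm_det_pow_mul (N : ℕ) {F : Matrix (Fin n) (Fin n) ℂ → ℝ≥0∞}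
    (hF : Measurable F) : Measurable fun x => ‖x.det‖ₑ ^ N * F x :=
  (measurable_enorm_det.pow_const N).mul hF

theorem measurable_enorm_det_pow_inv_mul (N : ℕ) {F : Matrix (Fin n) (Fin n) ℂ → ℝ≥0∞}
    (hF : Measurable F) : Measurable fun x => (‖x.det‖ₑ ^ N)⁻¹ * F x :=
  (measurable_enorm_det_pow_inv N).mul hF

theorem lintegral_withDensity_enorm_det (N : ℕ) {β : Measure (Matrix (Fin n) (Fin n) ℂ)}
    {F : Matrix (Fin n) (Fin n) ℂ → ℝ≥0∞} (hF : Measurable F) :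
    ∫⁻ x, F x ∂(β.withDensity fun x => (‖x.det‖ₑ ^ N)⁻¹)
      = ∫⁻ x, (‖x.det‖ₑ ^ N)⁻¹ * F x ∂β :=
  lintegral_withDensity_eq_lintegral_mul _ (measurable_enorm_det_pow_inv N) hF

theorem measurable_comp_congr {F : Matrix (Fin n) (Fin n) ℂ → ℝ≥0∞} (hF : Measurable F)
    (g : Matrix (Fin n) (Fin n) ℂ) : Measurable fun x => F (g * x * gᴴ) := by
  have h := (hF.comp measurable_congr).comp (measurable_prodMk_left (x := g))
  exact h

theorem measurable_comp_mul_right {F : Matrix (Fin n) (Fin n) ℂ → ℝ≥0∞} (hF : Measurable F)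
    (s : Matrix (Fin n) (Fin n) ℂ) : Measurable fun g => F (g * s) := by
  have h : Continuous fun g : Matrix (Fin n) (Fin n) ℂ => g * s :=
    continuous_id.matrix_mul continuous_const
  have h' := hF.comp h.measurable
  exact h'

theorem IsRelCongrInvariant.isCongrInvariant {N : ℕ} {β : Measure (Matrix (Fin n) (Fin n) ℂ)}
    (hβ : IsRelCongrInvariant N β) :
    IsCongrInvariant (β.withDensity fun x => (‖x.det‖ₑ ^ N)⁻¹) := by
  intro g hg F hF
  have hd := enorm_det_ne_zero hg
  rw [lintegral_withDensity_enorm_det N hF,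
    lintegral_withDensity_enorm_det N (measurable_comp_congr hF g),
    ← hβ g hg _ (measurable_enorm_det_pow_inv_mul N hF), ← lintegral_const_mul]
  · refine lintegral_congr fun x => ?_
    have h : ‖(g * x * gᴴ).det‖ₑ ^ N = ‖g.det‖ₑ ^ (2 * N) * ‖x.det‖ₑ ^ N := by
      rw [Matrix.det_mul, Matrix.det_mul, Matrix.det_conjTranspose, enorm_mul, enorm_mul,
        pow_mul, ← mul_pow]
      have : ‖star g.det‖ₑ = ‖g.det‖ₑ := by simp [enorm_eq_nnnorm]
      rw [this]
      ring
    rw [h, ENNReal.mul_inv (by simp [hd]) (by simp), ← mul_assoc, ← mul_assoc,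
      ENNReal.mul_inv_cancel (by simp [hd]) (by simp), one_mul]
  · exact measurable_comp_congr (measurable_enorm_det_pow_inv_mul N hF) g

theorem isRightInvariant_withDensity {ν : Measure (Matrix (Fin n) (Fin n) ℂ)} {k : ℕ}
    (hν : ∀ s : Matrix (Fin n) (Fin n) ℂ, IsUnit s.det → ∀ F : Matrix (Fin n) (Fin n) ℂ → ℝ≥0∞,
      Measurable F → ‖s.det‖ₑ ^ k * ∫⁻ g, F (g * s) ∂ν = ∫⁻ g, F g ∂ν) :
    IsRightInvariant (ν.withDensity fun x => (‖x.det‖ₑ ^ k)⁻¹) := by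
  intro s hs F hF
  have hd := enorm_det_ne_zero hs
  rw [lintegral_withDensity_enorm_det k hF,
    lintegral_withDensity_enorm_det k (measurable_comp_mul_right hF s),
    ← hν s hs _ (measurable_enorm_det_pow_inv_mul k hF), ← lintegral_const_mul]
  · refine lintegral_congr fun x => ?_
    rw [Matrix.det_mul, enorm_mul, mul_pow, mul_comm (‖x.det‖ₑ ^ k),
      ENNReal.mul_inv (by simp [hd]) (by simp), ← mul_assoc, ← mul_assoc,
      ENNReal.mul_inv_cancel (by simp [hd]) (by simp), one_mul]
  · exact measurable_comp_mul_right (measurable_enorm_det_pow_inv_mul k hF) s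

/-- Invertible matrices such that they and their inverses have all entries bounded by `2`. -/
def boundedUnits (n : ℕ) : Set (Matrix (Fin n) (Fin n) ℂ) :=
  {x | IsUnit x.det ∧ (∀ i j, ‖x i j‖ ≤ 2) ∧ ∀ i j, ‖x⁻¹ i j‖ ≤ 2}

theorem inv_mem_boundedUnits_iff {x : Matrix (Fin n) (Fin n) ℂ} (hx : IsUnit x.det) :
    x⁻¹ ∈ boundedUnits n ↔ x ∈ boundedUnits n := by
  simp only [boundedUnits, Set.mem_ofPred_eq, Matrix.isUnit_nonsing_inv_det_iff,
    Matrix.nonsing_inv_nonsing_inv _ hx]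
  tauto

theorem measurable_apply (i : Fin n) (j : Fin m) :
    Measurable fun x : Matrix (Fin n) (Fin m) ℂ => x i j :=
  (continuous_id.matrix_elem i j).measurable

theorem measurableSet_boundedUnits : MeasurableSet (boundedUnits n) := by
  have h0 : boundedUnits n = (fun x => ‖x.det‖ₑ) ⁻¹' {0}ᶜ ∩
      ((⋂ i, ⋂ j, {x | ‖x i j‖ ≤ 2}) ∩ ⋂ i, ⋂ j, {x | ‖x⁻¹ i j‖ ≤ 2}) := by
    ext x
    simp [boundedUnits]
  rw [h0]
  refine (measurable_enorm_det (measurableSet_singleton 0).compl).inter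
    (MeasurableSet.inter ?_ ?_)
  · exact MeasurableSet.iInter fun i => MeasurableSet.iInter fun j =>
      measurableSet_le (measurable_apply i j).norm measurable_const
  · refine MeasurableSet.iInter fun i => MeasurableSet.iInter fun j =>
      measurableSet_le ?_ measurable_const
    have h := (measurable_apply i j).comp (measurable_inv (n := n))
    exact h.norm

theorem boundedUnits_mem_nhds : boundedUnits n ∈ nhds (1 : Matrix (Fin n) (Fin n) ℂ) := by
  have h1 : ContinuousAt (fun x : Matrix (Fin n) (Fin n) ℂ => x⁻¹) 1 := by
    have : (fun x : Matrix (Fin n) (Fin n) ℂ => x⁻¹) = fun x => (x.det)⁻¹ • x.adjugate := by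
      ext1 x
      rw [Matrix.inv_def, Ring.inverse_eq_inv']
    rw [this]
    exact (continuous_id.matrix_det.continuousAt.inv₀ (by simp)).smul
      continuous_id.matrix_adjugate.continuousAt
  have hlt : ∀ i j, ‖(1 : Matrix (Fin n) (Fin n) ℂ) i j‖ < 2 := by
    intro i j
    rw [Matrix.one_apply]
    split_ifs <;> norm_num
  have e : ∀ i j, Continuous fun x : Matrix (Fin n) (Fin n) ℂ => ‖x i j‖ := fun i j =>
    (continuous_id.matrix_elem i j).norm
  have e1 : ∀ᶠ x in nhds (1 : Matrix (Fin n) (Fin n) ℂ), x.det ≠ 0 :=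
    continuous_id.matrix_det.continuousAt.eventually_ne (by simp)
  have e2 : ∀ᶠ x in nhds (1 : Matrix (Fin n) (Fin n) ℂ), ∀ i j, ‖x i j‖ < 2 := by
    simp only [Filter.eventually_all]
    exact fun i j => (e i j).continuousAt.eventually_lt continuousAt_const (hlt i j)
  have e3 : ∀ᶠ x in nhds (1 : Matrix (Fin n) (Fin n) ℂ), ∀ i j, ‖x⁻¹ i j‖ < 2 := by
    have h2 : Filter.Tendsto (fun x : Matrix (Fin n) (Fin n) ℂ => x⁻¹) (nhds 1) (nhds 1) := by
      simpa [ContinuousAt] using h1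
    exact h2.eventually e2
  filter_upwards [e1, e2, e3] with x h1 h2 h3
  exact ⟨isUnit_iff_ne_zero.2 h1, fun i j => (h2 i j).le, fun i j => (h3 i j).le⟩

theorem exists_norm_det_le : ∃ C : NNReal, ∀ x : Matrix (Fin n) (Fin n) ℂ,
    (∀ i j, ‖x i j‖ ≤ 2) → ‖x.det‖₊ ≤ C := by
  refine ⟨(n.factorial * 2 ^ n : ℕ), fun x hx => ?_⟩
  have := Matrix.det_le (A := x) (abv := NormedField.toAbsoluteValue ℂ) (x := 2) hx
  have h : ‖x.det‖ ≤ (n.factorial * 2 ^ n : ℝ) := by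
    simpa [NormedField.toAbsoluteValue] using this
  rw [← NNReal.coe_le_coe]
  simpa using h

theorem withDensity_boundedUnits {β : Measure (Matrix (Fin n) (Fin n) ℂ)} (N : ℕ)
    (h0 : β (boundedUnits n) ≠ 0) (h1 : β (boundedUnits n) ≠ ∞) :
    β.withDensity (fun x => (‖x.det‖ₑ ^ N)⁻¹) (boundedUnits n) ≠ 0 ∧
    β.withDensity (fun x => (‖x.det‖ₑ ^ N)⁻¹) (boundedUnits n) ≠ ∞ := by
  rw [withDensity_apply _ measurableSet_boundedUnits]
  constructor
  · rw [Ne, lintegral_eq_zero_iff (measurable_enorm_det_pow_inv N)]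
    intro h
    have h2 : ∀ᵐ x ∂(β.restrict (boundedUnits n)), False := by
      filter_upwards [h] with x hx
      simp at hx
    simp only [Filter.eventually_false_iff_eq_bot, ae_eq_bot, Measure.restrict_eq_zero] at h2
    exact h0 h2
  · obtain ⟨C, hC⟩ := exists_norm_det_le (n := n)
    refine ne_of_lt (lt_of_le_of_lt (setLIntegral_mono' (g := fun _ => ((C ^ N : NNReal) : ℝ≥0∞))
      measurableSet_boundedUnits ?_) ?_)
    · intro x hx
      have hd := enorm_det_ne_zero hx.1
      have h3 := hC _ hx.2.2
      rw [Matrix.det_nonsing_inv, Ring.inverse_eq_inv', nnnorm_inv] at h3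
      rw [ENNReal.inv_pow, ENNReal.coe_pow, enorm_eq_nnnorm, ← ENNReal.coe_inv]
      · gcongr
      · simpa using hx.1.ne_zero
    · simpa using ENNReal.mul_lt_top (by simp) h1.lt_top

theorem lintegral_eq_lintegral_withDensity {N : ℕ} {β : Measure (Matrix (Fin n) (Fin n) ℂ)}
    (hβ : ∀ᵐ x ∂β, x.PosDef) {F : Matrix (Fin n) (Fin n) ℂ → ℝ≥0∞} (hF : Measurable F) :
    ∫⁻ x, ‖x.det‖ₑ ^ N * F x ∂(β.withDensity fun x => (‖x.det‖ₑ ^ N)⁻¹) = ∫⁻ x, F x ∂β := by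
  rw [lintegral_withDensity_enorm_det N (measurable_enorm_det_pow_mul N hF)]
  refine lintegral_congr_ae (hβ.mono fun x hx => ?_)
  have hd := enorm_det_ne_zero ((Matrix.isUnit_iff_isUnit_det x).1 hx.isUnit)
  dsimp only
  rw [← mul_assoc, ENNReal.inv_mul_cancel (by simp [hd]) (by simp), one_mul]

theorem ae_posDef_withDensity {β : Measure (Matrix (Fin n) (Fin n) ℂ)}
    (hβ : ∀ᵐ x ∂β, x.PosDef) (f : Matrix (Fin n) (Fin n) ℂ → ℝ≥0∞) :
    ∀ᵐ x ∂β.withDensity f, x.PosDef :=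
  (withDensity_absolutelyContinuous β f).ae_le hβ

theorem lintegral_indicator_inv_boundedUnits {α : Measure (Matrix (Fin n) (Fin n) ℂ)}
    (hα : ∀ᵐ x ∂α, x.PosDef) :
    ∫⁻ x, (boundedUnits n).indicator 1 x⁻¹ ∂α = α (boundedUnits n) := by
  rw [← lintegral_indicator_one measurableSet_boundedUnits]
  refine lintegral_congr_ae (hα.mono fun x hx => ?_)
  have h := inv_mem_boundedUnits_iff ((Matrix.isUnit_iff_isUnit_det x).1 hx.isUnit)
  by_cases hx' : x ∈ boundedUnits n
  · simp [hx', h.2 hx']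
  · simp [hx', mt h.1 hx']

theorem lintegral_mul_conjTranspose_withDensity (k : ℕ) {ν : Measure (Matrix (Fin n) (Fin n) ℂ)}
    {F : Matrix (Fin n) (Fin n) ℂ → ℝ≥0∞} (hF : Measurable F) :
    ∫⁻ g, F (g * gᴴ) ∂(ν.withDensity fun x => (‖x.det‖ₑ ^ (2 * k))⁻¹) =
      ∫⁻ x, F x ∂((ν.map fun g => g * gᴴ).withDensity fun x => (‖x.det‖ₑ ^ k)⁻¹) := by
  have hFs := hF.comp (measurable_mul_conjTranspose_self (n := n) (m := n))
  simp only [Function.comp_def] at hFs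
  rw [lintegral_withDensity_enorm_det k hF, lintegral_withDensity_enorm_det (2 * k) hFs,
    lintegral_map (measurable_enorm_det_pow_inv_mul k hF) measurable_mul_conjTranspose_self]
  refine lintegral_congr fun g => ?_
  rw [Matrix.det_mul, Matrix.det_conjTranspose, enorm_mul, pow_mul]
  have : ‖star g.det‖ₑ = ‖g.det‖ₑ := by simp [enorm_eq_nnnorm]
  rw [this, sq]

/-- Uniqueness of relatively invariant measures on the cone of positive definite matrices. -/
theorem exists_eq_smul_withDensity {ν β₁ β₂ : Measure (Matrix (Fin n) (Fin n) ℂ)}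
    [SFinite ν] [SFinite β₁] [SFinite β₂] {k N : ℕ} (hkN : k ≤ N)
    (hν : ∀ s : Matrix (Fin n) (Fin n) ℂ, IsUnit s.det → ∀ F : Matrix (Fin n) (Fin n) ℂ → ℝ≥0∞,
      Measurable F → ‖s.det‖ₑ ^ (2 * n) * ∫⁻ g, F (g * s) ∂ν = ∫⁻ g, F g ∂ν)
    (hν' : ∀ᵐ g ∂ν, IsUnit g.det)
    (hν0 : (ν.map fun g => g * gᴴ) (boundedUnits n) ≠ 0)
    (hν1 : (ν.map fun g => g * gᴴ) (boundedUnits n) ≠ ∞)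
    (h₁ : IsRelCongrInvariant N β₁) (h₁' : ∀ᵐ x ∂β₁, x.PosDef)
    (h₁0 : β₁ (boundedUnits n) ≠ 0) (h₁1 : β₁ (boundedUnits n) ≠ ∞)
    (h₂ : IsRelCongrInvariant k β₂) (h₂' : ∀ᵐ x ∂β₂, x.PosDef)
    (h₂0 : β₂ (boundedUnits n) ≠ 0) (h₂1 : β₂ (boundedUnits n) ≠ ∞) :
    ∃ c : ℝ≥0∞, c ≠ 0 ∧ c ≠ ∞ ∧
      β₁ = c • β₂.withDensity fun x => ‖x.det‖ₑ ^ (N - k) := by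
  set γ := ν.withDensity fun x => (‖x.det‖ₑ ^ (2 * n))⁻¹ with hγdef
  have hγ : IsRightInvariant γ := isRightInvariant_withDensity hν
  have hγ' : ∀ᵐ g ∂γ, IsUnit g.det := (withDensity_absolutelyContinuous ν _).ae_le hν'
  have hK : Measurable ((boundedUnits n).indicator (1 : Matrix (Fin n) (Fin n) ℂ → ℝ≥0∞)) :=
    measurable_one.indicator measurableSet_boundedUnits
  obtain ⟨B, hBdef⟩ : ∃ B, B = ∫⁻ g, (boundedUnits n).indicator 1 (g * gᴴ) ∂γ := ⟨_, rfl⟩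
  have hB : B ≠ 0 ∧ B ≠ ∞ := by
    have h := withDensity_boundedUnits n hν0 hν1
    rw [hBdef, hγdef, lintegral_mul_conjTranspose_withDensity n hK,
      lintegral_indicator_one measurableSet_boundedUnits]
    exact h
  have key : ∀ (β : Measure (Matrix (Fin n) (Fin n) ℂ)) [SFinite β] (l : ℕ),
      IsRelCongrInvariant l β → (∀ᵐ x ∂β, x.PosDef) →
      ∀ F : Matrix (Fin n) (Fin n) ℂ → ℝ≥0∞, Measurable F →
      B * ∫⁻ x, F x ∂(β.withDensity fun x => (‖x.det‖ₑ ^ l)⁻¹) =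
        (β.withDensity fun x => (‖x.det‖ₑ ^ l)⁻¹) (boundedUnits n) * ∫⁻ g, F (g * gᴴ) ∂γ := by
    intro β _ l hβ hβ' F hF
    have h := ae_posDef_withDensity hβ' fun x => (‖x.det‖ₑ ^ l)⁻¹
    rw [hBdef, lintegral_mul_lintegral_eq hγ hγ' hβ.isCongrInvariant h hF hK,
      lintegral_indicator_inv_boundedUnits h]
  obtain ⟨hA₁0, hA₁1⟩ := withDensity_boundedUnits N h₁0 h₁1
  obtain ⟨hA₂0, hA₂1⟩ := withDensity_boundedUnits k h₂0 h₂1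
  have k₁ := key β₁ N h₁ h₁'
  have k₂ := key β₂ k h₂ h₂'
  set A₁ := (β₁.withDensity fun x => (‖x.det‖ₑ ^ N)⁻¹) (boundedUnits n)
  set A₂ := (β₂.withDensity fun x => (‖x.det‖ₑ ^ k)⁻¹) (boundedUnits n)
  refine ⟨A₁ / A₂, ENNReal.div_ne_zero.2 ⟨hA₁0, hA₂1⟩, ENNReal.div_ne_top hA₁1 hA₂0, ?_⟩
  refine Measure.ext_of_lintegral _ fun F hF => ?_
  have e₂ : ∫⁻ x, F x ∂(β₂.withDensity fun x => ‖x.det‖ₑ ^ (N - k)) = ∫⁻ x, ‖x.det‖ₑ ^ N * F x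
        ∂(β₂.withDensity fun x => (‖x.det‖ₑ ^ k)⁻¹) := by
    have h : ∀ x : Matrix (Fin n) (Fin n) ℂ, ‖x.det‖ₑ ^ N * F x =
        ‖x.det‖ₑ ^ k * (‖x.det‖ₑ ^ (N - k) * F x) := by
      intro x
      rw [← mul_assoc, ← pow_add, Nat.add_sub_cancel' hkN]
    simp only [h]
    rw [lintegral_eq_lintegral_withDensity h₂' (measurable_enorm_det_pow_mul _ hF)]
    exact lintegral_withDensity_eq_lintegral_mul _ (measurable_enorm_det.pow_const _) hF
  rw [lintegral_smul_measure, ← lintegral_eq_lintegral_withDensity (N := N) h₁' hF, e₂]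
  have r₁ := k₁ _ (measurable_enorm_det_pow_mul N hF)
  have r₂ := k₂ _ (measurable_enorm_det_pow_mul N hF)
  have hinj : Function.Injective fun z => B * z := fun a b h => by
    exact (ENNReal.mul_right_inj hB.1 hB.2).1 h
  apply hinj
  dsimp only
  rw [r₁, smul_eq_mul, mul_left_comm, r₂, ← mul_assoc, ENNReal.div_mul_cancel hA₂0 hA₂1]

theorem lintegral_comp_linearMap {E : Type*} [AddCommGroup E] [Module ℝ E]
    [TopologicalSpace E] [IsTopologicalAddGroup E] [ContinuousSMul ℝ E] [T2Space E]
    [FiniteDimensional ℝ E] [MeasurableSpace E] [BorelSpace E] (μ : Measure E)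
    [μ.IsAddHaarMeasure] {L : E →ₗ[ℝ] E} (hL : LinearMap.det L ≠ 0) {F : E → ℝ≥0∞}
    (hF : Measurable F) :
    ‖LinearMap.det L‖ₑ * ∫⁻ x, F (L x) ∂μ = ∫⁻ x, F x ∂μ := by
  obtain ⟨e⟩ : Nonempty (E ≃L[ℝ] (Fin (Module.finrank ℝ E) → ℝ)) :=
    ⟨ContinuousLinearEquiv.ofFinrankEq (by simp)⟩
  have he : Measurable e := e.continuous.measurable
  have hes : Measurable e.symm := e.symm.continuous.measurable
  let L' : (Fin (Module.finrank ℝ E) → ℝ) →ₗ[ℝ] (Fin (Module.finrank ℝ E) → ℝ) :=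
    (e.toLinearEquiv : E →ₗ[ℝ] _) ∘ₗ L ∘ₗ (e.toLinearEquiv.symm : _ →ₗ[ℝ] E)
  have hdet : LinearMap.det L' = LinearMap.det L := LinearMap.det_conj L e.toLinearEquiv
  have hLm : Measurable L' := L'.continuous_of_finiteDimensional.measurable
  have hF' : Measurable fun y => F (e.symm y) := hF.comp hes
  have : (μ.map e).IsAddHaarMeasure := e.isAddHaarMeasure_map μ
  have h₁ : ∫⁻ x, F (L x) ∂μ = ∫⁻ y, F (e.symm (L' y)) ∂(μ.map e) := by
    have hm : Measurable fun y => F (e.symm (L' y)) := hF'.comp hLm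
    rw [lintegral_map hm he]
    simp [L']
  have h₂ : ∫⁻ x, F x ∂μ = ∫⁻ y, F (e.symm y) ∂(μ.map e) := by
    rw [lintegral_map hF' he]
    simp
  rw [h₁, h₂, ← lintegral_map hF' hLm,
    Measure.map_linearMap_addHaar_eq_smul_addHaar _ (hdet ▸ hL), lintegral_smul_measure,
    smul_eq_mul, ← mul_assoc, ← Real.enorm_eq_ofReal_abs, ← enorm_mul, hdet,
    mul_inv_cancel₀ hL]
  simp

/-- The linear map `X ↦ A X B`. -/
def sandwich (A : Matrix (Fin n) (Fin n) ℂ) (B : Matrix (Fin m) (Fin m) ℂ) :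
    Matrix (Fin n) (Fin m) ℂ →ₗ[ℂ] Matrix (Fin n) (Fin m) ℂ where
  toFun X := A * X * B
  map_add' X Y := by rw [Matrix.mul_add, Matrix.add_mul]
  map_smul' c X := by simp

/-- Column stacking as a linear equivalence. -/
def vecEquiv (n m : ℕ) : Matrix (Fin n) (Fin m) ℂ ≃ₗ[ℂ] (Fin m × Fin n → ℂ) where
  toFun := Matrix.vec
  map_add' := Matrix.vec_add
  map_smul' := Matrix.vec_smul
  invFun v := Matrix.of fun i j => v (j, i)
  left_inv _ := rfl
  right_inv _ := rfl

theorem det_sandwich (A : Matrix (Fin n) (Fin n) ℂ) (B : Matrix (Fin m) (Fin m) ℂ) :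
    LinearMap.det (sandwich A B) = A.det ^ m * B.det ^ n := by
  rw [← LinearMap.det_conj _ (vecEquiv n m)]
  have h : ((vecEquiv n m : _ →ₗ[ℂ] _) ∘ₗ sandwich A B ∘ₗ ((vecEquiv n m).symm : _ →ₗ[ℂ] _)) =
      Matrix.toLin' (Matrix.kronecker Bᵀ A) := by
    refine LinearMap.ext fun v => ?_
    obtain ⟨X, rfl⟩ := (vecEquiv n m).surjective v
    have := Matrix.kronecker_mulVec_vec A X Bᵀ
    rw [Matrix.transpose_transpose] at this
    rw [LinearMap.comp_apply, LinearMap.comp_apply, LinearEquiv.coe_coe, LinearEquiv.coe_coe,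
      LinearEquiv.symm_apply_apply, Matrix.toLin'_apply]
    exact this.symm
  rw [h, LinearMap.det_toLin']
  have := Matrix.det_kronecker Bᵀ A
  rw [Matrix.kronecker, this, Matrix.det_transpose, mul_comm]
  simp

theorem det_sandwich_real (A : Matrix (Fin n) (Fin n) ℂ) (B : Matrix (Fin m) (Fin m) ℂ) :
    LinearMap.det ((sandwich A B).restrictScalars ℝ) = ‖A.det ^ m * B.det ^ n‖ ^ 2 := by
  rw [LinearMap.det_restrictScalars, det_sandwich, Algebra.norm_complex_apply,
    Complex.normSq_eq_norm_sq]

instance : FiniteDimensional ℝ (Matrix (Fin n) (Fin m) ℂ) :=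
  inferInstanceAs (FiniteDimensional ℝ (Fin n → Fin m → ℂ))

theorem lintegral_sandwich (ν : Measure (Matrix (Fin n) (Fin m) ℂ)) [ν.IsAddHaarMeasure]
    {A : Matrix (Fin n) (Fin n) ℂ} {B : Matrix (Fin m) (Fin m) ℂ} (hA : IsUnit A.det)
    (hB : IsUnit B.det) {F : Matrix (Fin n) (Fin m) ℂ → ℝ≥0∞} (hF : Measurable F) :
    ‖A.det‖ₑ ^ (2 * m) * ‖B.det‖ₑ ^ (2 * n) * ∫⁻ X, F (A * X * B) ∂ν = ∫⁻ X, F X ∂ν := by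
  have hdet := det_sandwich_real A B
  have h0 : LinearMap.det ((sandwich A B).restrictScalars ℝ) ≠ 0 := by
    rw [hdet]
    exact pow_ne_zero _ (norm_ne_zero_iff.2
      (mul_ne_zero (pow_ne_zero _ hA.ne_zero) (pow_ne_zero _ hB.ne_zero)))
  rw [← lintegral_comp_linearMap ν h0 hF, hdet]
  congr 1
  simp only [enorm_pow, enorm_mul, enorm_norm]
  ring

/-- `Matrix.of` as a continuous linear equivalence. -/
noncomputable def ofCLE (n m : ℕ) : (Fin n → Fin m → ℂ) ≃L[ℝ] Matrix (Fin n) (Fin m) ℂ :=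
  { Matrix.ofLinearEquiv ℝ with
    continuous_toFun := continuous_id
    continuous_invFun := continuous_id }

/-- Lebesgue measure on the entries of a complex matrix. -/
noncomputable def lebesgue (n m : ℕ) : Measure (Matrix (Fin n) (Fin m) ℂ) :=
  (volume : Measure (Fin n → Fin m → ℂ)).map (ofCLE n m)

instance : (volume : Measure (Fin n → Fin m → ℂ)).IsAddHaarMeasure :=
  Measure.instIsAddHaarMeasureForallVolumeOfMeasurableAddOfSigmaFinite

instance : (lebesgue n m).IsAddHaarMeasure :=
  (ofCLE n m).isAddHaarMeasure_map _

theorem measurable_ofCLE : Measurable (ofCLE n m) := (ofCLE n m).continuous.measurable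

instance : SFinite (lebesgue n m) :=
  inferInstanceAs (SFinite ((volume : Measure (Fin n → Fin m → ℂ)).map (ofCLE n m)))

theorem lintegral_mul_left_lebesgue {A : Matrix (Fin n) (Fin n) ℂ} (hA : IsUnit A.det)
    {F : Matrix (Fin n) (Fin m) ℂ → ℝ≥0∞} (hF : Measurable F) :
    ‖A.det‖ₑ ^ (2 * m) * ∫⁻ X, F (A * X) ∂(lebesgue n m) = ∫⁻ X, F X ∂(lebesgue n m) := by
  simpa using lintegral_sandwich (lebesgue n m) hA (B := 1) (by simp) hF

theorem lintegral_mul_right_lebesgue {B : Matrix (Fin m) (Fin m) ℂ} (hB : IsUnit B.det)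
    {F : Matrix (Fin n) (Fin m) ℂ → ℝ≥0∞} (hF : Measurable F) :
    ‖B.det‖ₑ ^ (2 * n) * ∫⁻ X, F (X * B) ∂(lebesgue n m) = ∫⁻ X, F X ∂(lebesgue n m) := by
  simpa using lintegral_sandwich (lebesgue n m) (A := 1) (by simp) hB hF

/-- The image of Lebesgue measure under `Ψ ↦ Ψ Ψᴴ`. -/
noncomputable def wishart (n m : ℕ) : Measure (Matrix (Fin n) (Fin n) ℂ) :=
  (lebesgue n m).map fun g => g * gᴴ

instance : SFinite (wishart n m) :=
  inferInstanceAs (SFinite ((lebesgue n m).map fun g => g * gᴴ))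

theorem lintegral_wishart {F : Matrix (Fin n) (Fin n) ℂ → ℝ≥0∞} (hF : Measurable F) :
    ∫⁻ x, F x ∂(wishart n m) = ∫⁻ g, F (g * gᴴ) ∂(lebesgue n m) :=
  lintegral_map hF measurable_mul_conjTranspose_self

theorem isRelCongrInvariant_wishart : IsRelCongrInvariant m (wishart n m) := by
  intro g hg F hF
  have hF' : Measurable fun x : Matrix (Fin n) (Fin m) ℂ => F (x * xᴴ) := by
    have h := hF.comp (measurable_mul_conjTranspose_self (n := n) (m := m))
    exact h
  rw [lintegral_wishart hF, lintegral_wishart (measurable_comp_congr hF g),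
    ← lintegral_mul_left_lebesgue hg hF']
  simp only [Matrix.conjTranspose_mul, Matrix.mul_assoc]

/-- The first `n` rows of the identity matrix of size `m`. -/
def rowIsometry (hnm : n ≤ m) : Matrix (Fin n) (Fin m) ℂ :=
  (1 : Matrix (Fin m) (Fin m) ℂ).submatrix (Fin.castLE hnm) id

theorem rowIsometry_mul_conjTranspose (hnm : n ≤ m) :
    rowIsometry hnm * (rowIsometry hnm)ᴴ = 1 := by
  ext i j
  simp [rowIsometry, Matrix.mul_apply, Matrix.one_apply, (Fin.castLE_injective hnm).eq_iff, eq_comm]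

theorem ae_det_add_smul_ne_zero (M : Matrix (Fin n) (Fin n) ℂ) :
    ∀ᵐ t : ℝ, (M + (t : ℂ) • 1).det ≠ 0 := by
  have hfin : {t : ℝ | (M + (t : ℂ) • 1).det = 0}.Finite := by
    refine ((-M).charpoly.rootSet_finite ℂ).preimage
      (f := fun t : ℝ => (t : ℂ)) Complex.ofReal_injective.injOn |>.subset fun t ht => ?_
    rw [Set.mem_preimage, Polynomial.mem_rootSet]
    refine ⟨(Matrix.charpoly_monic _).ne_zero, ?_⟩
    rw [Polynomial.coe_aeval_eq_eval, Matrix.eval_charpoly, ← ht, Matrix.scalar_apply,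
      ← Matrix.smul_one_eq_diagonal, sub_neg_eq_add, add_comm]
  rw [ae_iff]
  simpa using hfin.measure_zero volume

theorem posDef_mul_conjTranspose_of_det_ne_zero {X E : Matrix (Fin n) (Fin m) ℂ}
    (h : (X * Eᴴ).det ≠ 0) : (X * Xᴴ).PosDef := by
  refine Matrix.PosDef.mul_conjTranspose_self X fun v w hvw => ?_
  have hinj : Function.Injective fun v => v ᵥ* (X * Eᴴ) :=
    Matrix.vecMul_injective_iff_isUnit.2 ((Matrix.isUnit_iff_isUnit_det _).2 h.isUnit)
  apply hinj
  simp only [← Matrix.vecMul_vecMul]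
  exact congrArg (· ᵥ* Eᴴ) hvw

theorem ae_posDef_mul_conjTranspose (hnm : n ≤ m) :
    ∀ᵐ X ∂(lebesgue n m), (X * Xᴴ).PosDef := by
  have hmeas : Measurable fun X : Matrix (Fin n) (Fin m) ℂ => (X * (rowIsometry hnm)ᴴ).det :=
    (continuous_id.matrix_mul continuous_const).matrix_det.measurable
  have hs : MeasurableSet {X : Matrix (Fin n) (Fin m) ℂ | (X * (rowIsometry hnm)ᴴ).det ≠ 0} :=
    hmeas (measurableSet_singleton 0).compl
  suffices ∀ᵐ X ∂(lebesgue n m), (X * (rowIsometry hnm)ᴴ).det ≠ 0 from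
    this.mono fun X hX => posDef_mul_conjTranspose_of_det_ne_zero hX
  refine (ae_map_iff measurable_ofCLE.aemeasurable hs).2 ?_
  refine ae_mem_of_ae_add_linearMap_mem (E := ℝ)
    (s := {x : Fin n → Fin m → ℂ | (ofCLE n m x * (rowIsometry hnm)ᴴ).det ≠ 0})
    (LinearMap.toSpanSingleton ℝ (Fin n → Fin m → ℂ) ((ofCLE n m).symm (rowIsometry hnm)))
    volume volume (measurable_ofCLE hs) fun y => ?_
  refine (ae_det_add_smul_ne_zero (ofCLE n m y * (rowIsometry hnm)ᴴ)).mono fun t ht => ?_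
  rw [Set.mem_ofPred_eq, LinearMap.toSpanSingleton_apply, map_add, map_smul,
    ContinuousLinearEquiv.apply_symm_apply, Matrix.add_mul, Matrix.smul_mul,
    rowIsometry_mul_conjTranspose]
  simpa using ht

theorem measurableSet_posDef : MeasurableSet {x : Matrix (Fin n) (Fin n) ℂ | x.PosDef} := by
  have h₁ : IsClosed {x : Matrix (Fin n) (Fin n) ℂ | x.PosSemidef} := by
    simp only [Matrix.posSemidef_iff_dotProduct_mulVec, Set.ofPred_and, Set.ofPred_forall]
    refine (isClosed_eq continuous_id.matrix_conjTranspose continuous_id).inter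
      (isClosed_iInter fun v => isClosed_le continuous_const ?_)
    exact continuous_const.dotProduct (continuous_id.matrix_mulVec continuous_const)
  have h₂ : MeasurableSet {x : Matrix (Fin n) (Fin n) ℂ | x.det ≠ 0} :=
    continuous_id.matrix_det.measurable (measurableSet_singleton 0).compl
  convert h₁.measurableSet.inter h₂ using 1
  ext x
  exact ⟨fun h => ⟨h.posSemidef, h.det_pos.ne'⟩,
    fun h => (Matrix.PosSemidef.posDef_iff_det_ne_zero h.1).2 h.2⟩

theorem ae_posDef_wishart (hnm : n ≤ m) : ∀ᵐ x ∂(wishart n m), x.PosDef :=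
  (ae_map_iff measurable_mul_conjTranspose_self.aemeasurable measurableSet_posDef).2
    (ae_posDef_mul_conjTranspose hnm)

theorem ae_isUnit_det_lebesgue : ∀ᵐ g ∂(lebesgue n n), IsUnit g.det := by
  refine (ae_posDef_mul_conjTranspose le_rfl).mono fun g hg => ?_
  have h := (Matrix.isUnit_iff_isUnit_det _).1 hg.isUnit
  rw [Matrix.det_mul] at h
  exact isUnit_of_mul_isUnit_left h

theorem wishart_boundedUnits_ne_zero (hnm : n ≤ m) : wishart n m (boundedUnits n) ≠ 0 := by
  rw [wishart, Measure.map_apply measurable_mul_conjTranspose_self measurableSet_boundedUnits]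
  have hc : Continuous fun g : Matrix (Fin n) (Fin m) ℂ => g * gᴴ :=
    continuous_id.matrix_mul continuous_id.matrix_conjTranspose
  refine (Measure.measure_pos_of_mem_nhds (lebesgue n m) (x := rowIsometry hnm)
    (hc.continuousAt.preimage_mem_nhds ?_)).ne'
  rw [rowIsometry_mul_conjTranspose]
  exact boundedUnits_mem_nhds

theorem wishart_boundedUnits_ne_top : wishart n m (boundedUnits n) ≠ ∞ := by
  rw [wishart, Measure.map_apply measurable_mul_conjTranspose_self measurableSet_boundedUnits]
  have hK : IsCompact (Set.pi Set.univ fun _ : Fin n => Set.pi Set.univ fun _ : Fin m =>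
      Metric.closedBall (0 : ℂ) 2) :=
    isCompact_univ_pi fun _ => isCompact_univ_pi fun _ => isCompact_closedBall _ _
  have hK' := hK.image (ofCLE n m).continuous
  refine ((measure_mono fun X hX => ?_).trans_lt hK'.measure_lt_top).ne
  refine ⟨(ofCLE n m).symm X, fun i _ j _ => ?_, (ofCLE n m).apply_symm_apply X⟩
  have h : ‖(X * Xᴴ) i i‖ ≤ 2 := hX.2.1 i i
  have hs : (X * Xᴴ) i i = ((∑ k, ‖X i k‖ ^ 2 : ℝ) : ℂ) := by
    simp [Matrix.mul_apply, Complex.mul_conj, Complex.normSq_eq_norm_sq]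
  rw [hs, Complex.norm_of_nonneg (Finset.sum_nonneg fun k _ => sq_nonneg _)] at h
  have hk : ‖X i j‖ ^ 2 ≤ 2 := (Finset.single_le_sum (f := fun k => ‖X i k‖ ^ 2)
    (fun k _ => sq_nonneg _) (Finset.mem_univ j)).trans h
  rw [mem_closedBall_zero_iff]
  change ‖X i j‖ ≤ 2
  nlinarith [norm_nonneg (X i j)]

/-- The real vector space of Hermitian matrices of size `n`. -/
abbrev Herm (n : ℕ) := selfAdjoint (Matrix (Fin n) (Fin n) ℂ)

theorem isClosedEmbedding_coe_herm :
    Topology.IsClosedEmbedding ((↑) : Herm n → Matrix (Fin n) (Fin n) ℂ) := by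
  refine Topology.IsClosedEmbedding.subtypeVal ?_
  exact isClosed_eq continuous_id.matrix_conjTranspose continuous_id

/-- The inclusion of Hermitian matrices into all matrices, as a real linear map. -/
def hermSubtype (n : ℕ) : Herm n →ₗ[ℝ] Matrix (Fin n) (Fin n) ℂ where
  toFun H := H
  map_add' _ _ := rfl
  map_smul' _ _ := rfl

instance : ContinuousSMul ℝ (Herm n) :=
  ⟨Continuous.subtype_mk (continuous_fst.smul (continuous_subtype_val.comp continuous_snd)) _⟩

instance : SigmaCompactSpace (Herm n) := by
  have : SigmaCompactSpace (Matrix (Fin n) (Fin n) ℂ) :=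
    inferInstanceAs (SigmaCompactSpace (Fin n → Fin n → ℂ))
  exact isClosedEmbedding_coe_herm.sigmaCompactSpace

instance : FiniteDimensional ℝ (Herm n) :=
  FiniteDimensional.of_injective (hermSubtype n) Subtype.val_injective

/-- The congruence action `H ↦ g H gᴴ` on Hermitian matrices. -/
def hermCongr (g : Matrix (Fin n) (Fin n) ℂ) : Herm n →ₗ[ℝ] Herm n where
  toFun H := ⟨g * H * gᴴ, H.2.conjugate g⟩
  map_add' H K := by
    ext1
    simp [Matrix.mul_add, Matrix.add_mul]
  map_smul' c H := by
    ext1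
    simp

/-- The decomposition of a matrix as `a + i b` with `a` and `b` Hermitian. -/
noncomputable def hermProdEquiv (n : ℕ) : (Herm n × Herm n) ≃ₗ[ℝ] Matrix (Fin n) (Fin n) ℂ where
  toFun p := p.1 + Complex.I • (p.2 : Matrix (Fin n) (Fin n) ℂ)
  map_add' p q := by
    simp only [Prod.fst_add, Prod.snd_add, AddSubgroup.coe_add, smul_add]
    abel
  map_smul' c p := by
    simp only [Prod.smul_fst, Prod.smul_snd, selfAdjoint.val_smul, smul_add, RingHom.id_apply]
    rw [smul_comm]
  invFun x := (realPart x, imaginaryPart x)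
  left_inv p := by
    simp [realPart_I_smul, imaginaryPart_I_smul, imaginaryPart_eq_zero_iff.2,
      selfAdjoint.realPart_coe]
  right_inv x := realPart_add_I_smul_imaginaryPart x

theorem det_hermCongr_sq (g : Matrix (Fin n) (Fin n) ℂ) :
    LinearMap.det (hermCongr g) ^ 2 = (‖g.det‖ ^ (2 * n)) ^ 2 := by
  have h : ((hermProdEquiv n : _ →ₗ[ℝ] _) ∘ₗ ((hermCongr g).prodMap (hermCongr g)) ∘ₗ
      ((hermProdEquiv n).symm : _ →ₗ[ℝ] _)) = (sandwich g gᴴ).restrictScalars ℝ := by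
    refine LinearMap.ext fun x => ?_
    obtain ⟨p, rfl⟩ := (hermProdEquiv n).surjective x
    simp only [LinearMap.comp_apply, LinearEquiv.coe_coe, LinearEquiv.symm_apply_apply]
    simp [hermProdEquiv, sandwich, hermCongr, Matrix.mul_add, Matrix.add_mul]
  have h' := LinearMap.det_conj ((hermCongr g).prodMap (hermCongr g)) (hermProdEquiv n)
  rw [h, LinearMap.det_prodMap, det_sandwich_real] at h'
  rw [sq, ← h', Matrix.det_conjTranspose, norm_mul, norm_pow, norm_pow, norm_star]
  ring

theorem enorm_det_hermCongr (g : Matrix (Fin n) (Fin n) ℂ) :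
    ‖LinearMap.det (hermCongr g)‖ₑ = ‖g.det‖ₑ ^ (2 * n) := by
  have h := abs_eq_abs.2 (sq_eq_sq_iff_eq_or_eq_neg.1 (det_hermCongr_sq g))
  rw [Real.enorm_eq_ofReal_abs, h, ← Real.enorm_eq_ofReal_abs, enorm_pow, enorm_norm]

variable (μ : Measure (Herm n))

theorem measurable_coe_herm : Measurable ((↑) : Herm n → Matrix (Fin n) (Fin n) ℂ) :=
  measurable_subtype_coe

/-- Lebesgue measure on the cone of positive definite matrices. -/
noncomputable def posDefMeasure : Measure (Matrix (Fin n) (Fin n) ℂ) :=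
  (μ.restrict {H | (H : Matrix (Fin n) (Fin n) ℂ).PosDef}).map (↑)

instance [μ.IsAddHaarMeasure] : SFinite (posDefMeasure μ) :=
  inferInstanceAs (SFinite
    ((μ.restrict {H | (H : Matrix (Fin n) (Fin n) ℂ).PosDef}).map Subtype.val))

theorem measurableSet_posDef_herm :
    MeasurableSet {H : Herm n | (H : Matrix (Fin n) (Fin n) ℂ).PosDef} :=
  measurable_coe_herm measurableSet_posDef

theorem ae_posDef_posDefMeasure : ∀ᵐ x ∂(posDefMeasure μ), x.PosDef :=
  (ae_map_iff measurable_coe_herm.aemeasurable measurableSet_posDef).2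
    (ae_restrict_mem measurableSet_posDef_herm)

theorem isRelCongrInvariant_posDefMeasure [μ.IsAddHaarMeasure] :
    IsRelCongrInvariant n (posDefMeasure μ) := by
  intro g hg F hF
  have hdet : LinearMap.det (hermCongr g) ≠ 0 := by
    rw [← enorm_ne_zero, enorm_det_hermCongr]
    exact pow_ne_zero _ (enorm_det_ne_zero hg)
  let G : Herm n → ℝ≥0∞ :=
    {H : Herm n | (H : Matrix (Fin n) (Fin n) ℂ).PosDef}.indicator fun H => F H
  have hFc : Measurable fun H : Herm n => F H := by
    have h := hF.comp (measurable_coe_herm (n := n))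
    exact h
  have hG : Measurable G := hFc.indicator measurableSet_posDef_herm
  rw [posDefMeasure, lintegral_map hF measurable_coe_herm,
    lintegral_map (measurable_comp_congr hF g) measurable_coe_herm,
    ← lintegral_indicator measurableSet_posDef_herm,
    ← lintegral_indicator measurableSet_posDef_herm]
  have h := lintegral_comp_linearMap μ hdet hG
  rw [enorm_det_hermCongr] at h
  refine Eq.trans ?_ h
  congr 1
  refine lintegral_congr fun H => ?_
  have hiff : (g * H * gᴴ).PosDef ↔ (H : Matrix (Fin n) (Fin n) ℂ).PosDef :=
    Matrix.IsUnit.posDef_star_right_conjugate_iff ((Matrix.isUnit_iff_isUnit_det g).2 hg)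
  have hmem : g * H * gᴴ ∈ {x : Matrix (Fin n) (Fin n) ℂ | x.PosDef} ↔
      (H : Matrix (Fin n) (Fin n) ℂ) ∈ {x : Matrix (Fin n) (Fin n) ℂ | x.PosDef} := hiff
  classical
  change ite _ _ _ = ite _ _ _
  exact if_congr hmem.symm rfl rfl

theorem eventually_posDef_herm :
    ∀ᶠ H : Herm n in nhds 1, (H : Matrix (Fin n) (Fin n) ℂ).PosDef := by
  have hcont : ∀ i j, Continuous fun H : Herm n => (H : Matrix (Fin n) (Fin n) ℂ) i j :=
    fun i j => continuous_subtype_val.matrix_elem i j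
  have h : ∀ᶠ H : Herm n in nhds 1, ∀ k,
      (∑ j ∈ Finset.univ.erase k, ‖(H : Matrix (Fin n) (Fin n) ℂ) k j‖) <
        ((H : Matrix (Fin n) (Fin n) ℂ) k k).re := by
    refine Filter.eventually_all.2 fun k => ?_
    refine (continuous_finsetSum _ fun j _ => (hcont k j).norm).continuousAt.eventually_lt
      (Complex.continuous_re.comp (hcont k k)).continuousAt ?_
    rw [Finset.sum_eq_zero]
    · simp
    · intro j hj
      simp [Matrix.one_apply_ne (Finset.ne_of_mem_erase hj).symm]
  refine h.mono fun H hH => ?_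
  have hh : (H : Matrix (Fin n) (Fin n) ℂ).IsHermitian := H.2
  refine hh.posDef_iff_eigenvalues_pos.2 fun i => ?_
  have hev : Module.End.HasEigenvalue (Matrix.toLin' (H : Matrix (Fin n) (Fin n) ℂ))
      (hh.eigenvalues i : ℂ) := by
    refine Module.End.hasEigenvalue_of_hasEigenvector (x := hh.eigenvectorBasis i) ⟨?_, ?_⟩
    · rw [Module.End.mem_eigenspace_iff, Matrix.toLin'_apply, hh.mulVec_eigenvectorBasis]
      rfl
    · intro h0
      exact hh.eigenvectorBasis.orthonormal.ne_zero i (PiLp.ext fun j => congrFun h0 j)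
  obtain ⟨k, hk⟩ := eigenvalue_mem_ball hev
  have h₁ := (Complex.abs_re_le_norm _).trans (mem_closedBall_iff_norm.1 hk)
  rw [Complex.sub_re, Complex.ofReal_re] at h₁
  linarith [hH k, neg_abs_le (hh.eigenvalues i - ((H : Matrix (Fin n) (Fin n) ℂ) k k).re)]

theorem posDefMeasure_apply_boundedUnits : posDefMeasure μ (boundedUnits n) =
    μ ((↑) ⁻¹' boundedUnits n ∩ {H : Herm n | (H : Matrix (Fin n) (Fin n) ℂ).PosDef}) := by
  rw [posDefMeasure, Measure.map_apply measurable_coe_herm measurableSet_boundedUnits,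
    Measure.restrict_apply (measurable_coe_herm measurableSet_boundedUnits)]

theorem posDefMeasure_boundedUnits_ne_zero [μ.IsAddHaarMeasure] :
    posDefMeasure μ (boundedUnits n) ≠ 0 := by
  rw [posDefMeasure_apply_boundedUnits]
  refine (Measure.measure_pos_of_mem_nhds μ (x := (1 : Herm n))
    (Filter.inter_mem ?_ eventually_posDef_herm)).ne'
  exact continuous_subtype_val.continuousAt.preimage_mem_nhds boundedUnits_mem_nhds

theorem posDefMeasure_boundedUnits_ne_top [μ.IsAddHaarMeasure] :
    posDefMeasure μ (boundedUnits n) ≠ ∞ := by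
  rw [posDefMeasure_apply_boundedUnits]
  have hK : IsCompact (Set.pi Set.univ fun _ : Fin n => Set.pi Set.univ fun _ : Fin n =>
      Metric.closedBall (0 : ℂ) 2) :=
    isCompact_univ_pi fun _ => isCompact_univ_pi fun _ => isCompact_closedBall _ _
  have hK' := isClosedEmbedding_coe_herm.isCompact_preimage (hK.image (ofCLE n n).continuous)
  refine ((measure_mono fun H hH => ?_).trans_lt hK'.measure_lt_top).ne
  refine ⟨(ofCLE n n).symm H, fun i _ j _ => ?_, (ofCLE n n).apply_symm_apply _⟩
  exact mem_closedBall_zero_iff.2 (hH.1.2.1 i j)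

theorem exists_wishart_eq_smul_withDensity (hnm : n ≤ m) [μ.IsAddHaarMeasure] :
    ∃ c : ℝ≥0∞, c ≠ 0 ∧ c ≠ ∞ ∧
      wishart n m = c • (posDefMeasure μ).withDensity fun x => ‖x.det‖ₑ ^ (m - n) :=
  exists_eq_smul_withDensity hnm (ν := lebesgue n n)
    (fun _ hs _ hF => lintegral_mul_right_lebesgue hs hF) ae_isUnit_det_lebesgue
    (wishart_boundedUnits_ne_zero le_rfl) wishart_boundedUnits_ne_top
    isRelCongrInvariant_wishart (ae_posDef_wishart hnm)
    (wishart_boundedUnits_ne_zero hnm) wishart_boundedUnits_ne_top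
    (isRelCongrInvariant_posDefMeasure μ) (ae_posDef_posDefMeasure μ)
    (posDefMeasure_boundedUnits_ne_zero μ) (posDefMeasure_boundedUnits_ne_top μ)

theorem integral_wishart {f : Matrix (Fin n) (Fin n) ℂ → ℂ} (hf : Continuous f) :
    ∫ x, f x ∂(wishart n m) =
      ∫ Ψ : Fin n → Fin m → ℂ, f (Matrix.of Ψ * (Matrix.of Ψ)ᴴ) := by
  have hc : Continuous fun g : Matrix (Fin n) (Fin m) ℂ => f (g * gᴴ) :=
    hf.comp (continuous_id.matrix_mul continuous_id.matrix_conjTranspose)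
  rw [wishart, integral_map measurable_mul_conjTranspose_self.aemeasurable
    hf.measurable.aestronglyMeasurable, lebesgue,
    integral_map measurable_ofCLE.aemeasurable hc.measurable.aestronglyMeasurable]
  rfl

theorem integral_posDefMeasure_withDensity (k : ℕ) {f : Matrix (Fin n) (Fin n) ℂ → ℂ}
    (hf : Continuous f) :
    ∫ x, f x ∂((posDefMeasure μ).withDensity fun x => ‖x.det‖ₑ ^ k) =
      ∫ H in {H : Herm n | (H : Matrix (Fin n) (Fin n) ℂ).PosDef},
        (H : Matrix (Fin n) (Fin n) ℂ).det ^ k * f H ∂μ := by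
  have hd : Continuous fun x : Matrix (Fin n) (Fin n) ℂ => ‖x.det‖₊ ^ k :=
    continuous_id.matrix_det.nnnorm.pow k
  have h : (fun x : Matrix (Fin n) (Fin n) ℂ => ‖x.det‖ₑ ^ k) =
      fun x => ((‖x.det‖₊ ^ k : NNReal) : ℝ≥0∞) := by
    ext x
    simp [enorm_eq_nnnorm]
  have hs : Continuous fun x : Matrix (Fin n) (Fin n) ℂ => ‖x.det‖₊ ^ k • f x := hd.smul hf
  rw [h, integral_withDensity_eq_integral_smul hd.measurable, posDefMeasure,
    integral_map measurable_coe_herm.aemeasurable hs.measurable.aestronglyMeasurable]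
  refine setIntegral_congr_fun measurableSet_posDef_herm fun H hH => ?_
  have hdet : ((‖(H : Matrix (Fin n) (Fin n) ℂ).det‖ : ℝ) : ℂ) =
      (H : Matrix (Fin n) (Fin n) ℂ).det := by
    have hpos : (H : Matrix (Fin n) (Fin n) ℂ).PosDef := hH
    exact Complex.norm_of_nonneg' hpos.det_pos.le
  simp only [NNReal.smul_def, NNReal.coe_pow, coe_nnnorm, Complex.real_smul, Complex.ofReal_pow,
    hdet]

end MatrixWishart

/-- Purely bosonic superbosonisation (`n_f = 0`): for `N ≥ n ≥ 1` there is a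
constant `c > 0` such that for every continuous compactly supported `f` on
`n × n` complex matrices,
`∫ f(Ψ Ψᴴ) dΨ = c ∫_{H > 0} (det H)^{N-n} f(H) dH`,
where `Ψ` runs over `n × N` complex matrices with Lebesgue measure and the
right-hand integral is over positive definite Hermitian matrices with respect
to a (Lebesgue, i.e. additive Haar) measure `μ` on the real vector space of
Hermitian `n × n` matrices. -/
theorem stmt_15 (n N : ℕ) (hn : 1 ≤ n) (hN : n ≤ N)
    (μ : Measure (selfAdjoint (Matrix (Fin n) (Fin n) ℂ)))
    [μ.IsAddHaarMeasure] :
    ∃ c : ℝ, 0 < c ∧ ∀ f : Matrix (Fin n) (Fin n) ℂ → ℂ,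
      Continuous f → HasCompactSupport f →
      ∫ Ψ : Fin n → Fin N → ℂ, f (Matrix.of Ψ * (Matrix.of Ψ)ᴴ)
        = (c : ℂ) *
          ∫ H in {H : selfAdjoint (Matrix (Fin n) (Fin n) ℂ) |
              Matrix.PosDef (H : Matrix (Fin n) (Fin n) ℂ)},
            ((H : Matrix (Fin n) (Fin n) ℂ).det) ^ (N - n) *
              f (H : Matrix (Fin n) (Fin n) ℂ) ∂μ := by
  obtain ⟨c, hc₀, hc, h⟩ := MatrixWishart.exists_wishart_eq_smul_withDensity (m := N) μ hN
  refine ⟨c.toReal, ENNReal.toReal_pos hc₀ hc, fun f hf _ => ?_⟩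
  rw [← MatrixWishart.integral_wishart hf, h, integral_smul_measure,
    MatrixWishart.integral_posDefMeasure_withDensity μ _ hf, Complex.real_smul]
end
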